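/- Assume the ℝ-action on X is cofinal. Then the spectral pseudo-distance d_spec satisfies: d_spec(x, x) = 0 and d_spec(x, y) ≥ 0 for all x, y; d_spec(x, y) = d_spec(y, x); d_spec(x, z) ≤ d_spec(x, y) + d_spec(y, z); the Lipschitz estimate |ℓ₊(x, z) - ℓ₊(y, z)| ≤ d_spec(x, y) for all x, y, z ∈ X; and the partially ordered metric space property: a ⪯ b and b ⪯ c imply d_spec(a, b) ≤ d_spec(a, c). (The Legendrian spectral pseudo-metric, inequality (3.1) and Proposition 3.9 of the paper.) -/

import Mathlib

/-- The maximal Legendrian order spectral selector `ℓ₊`. -/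
noncomputable def lplus {X : Type*} (r : X → X → Prop) (act : ℝ → X → X) (x y : X) : ℝ :=
  sInf {t : ℝ | r x (act t y)}

/-- The Legendrian spectral pseudo-distance `d_spec(x, y) = max (ℓ₊(x, y), ℓ₊(y, x))`. -/
noncomputable def dSpecLeg {X : Type*} (r : X → X → Prop) (act : ℝ → X → X) (x y : X) : ℝ :=
  max (lplus r act x y) (lplus r act y x)

/-- In an order with a monotone free flow, `act s x ⪯ act t x` forces `s ≤ t`. -/
theorem le_of_rel_act {X : Type*} {r : X → X → Prop} {act : ℝ → X → X}
    (hantisymm : ∀ x y, r x y → r y x → x = y)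
    (hactadd : ∀ (s t : ℝ) (x : X), act (s + t) x = act s (act t x))
    (hflowmono : ∀ s t : ℝ, s ≤ t → ∀ x : X, r (act s x) (act t x))
    (hfree : ∀ (t : ℝ) (x : X), act t x = x → t = 0)
    {s t : ℝ} {x : X} (h : r (act s x) (act t x)) : s ≤ t := by
  by_contra! hlt
  have heq : act s x = act t x := hantisymm _ _ h (hflowmono t s hlt.le x)
  have hzero : s - t = 0 := by
    apply hfree (s - t) (act t x)
    rw [← hactadd, sub_add_cancel, heq]
  linarith

/-- The selector `ℓ₊(x, y)` is at most every `t` with `x ⪯ t • y`. -/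
theorem lplus_le {X : Type*} {r : X → X → Prop} {act : ℝ → X → X} {x y : X} {t : ℝ}
    (hbdd : BddBelow {t : ℝ | r x (act t y)}) (h : r x (act t y)) :
    lplus r act x y ≤ t :=
  csInf_le hbdd h

/-- The triangle inequality for `ℓ₊`. -/
theorem lplus_triangle {X : Type*} {r : X → X → Prop} {act : ℝ → X → X}
    (htrans : ∀ x y z, r x y → r y z → r x z)
    (hactadd : ∀ (s t : ℝ) (x : X), act (s + t) x = act s (act t x))
    (hactmono : ∀ (t : ℝ) (x y : X), r x y → r (act t x) (act t y))
    (hbdd : ∀ x y : X, BddBelow {t : ℝ | r x (act t y)})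
    (hne : ∀ x y : X, {t : ℝ | r x (act t y)}.Nonempty) (x y z : X) :
    lplus r act x z ≤ lplus r act x y + lplus r act y z := by
  have key : ∀ s t : ℝ, r x (act s y) → r y (act t z) → lplus r act x z ≤ s + t := by
    intro s t hs ht
    apply lplus_le (hbdd x z)
    rw [hactadd]
    exact htrans _ _ _ hs (hactmono s _ _ ht)
  have hright : ∀ s : ℝ, r x (act s y) → lplus r act x z - s ≤ lplus r act y z :=
    fun s hs => le_csInf (hne y z) fun t ht => by linarith [key s t hs ht]
  have hleft : lplus r act x z - lplus r act y z ≤ lplus r act x y :=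
    le_csInf (hne x y) fun s hs => by linarith [hright s hs]
  linarith

/-- the Legendrian spectral pseudo-distance is a pseudo-metric,
the selectors are 1-Lipschitz with respect to it, and it endows `(X, ⪯)` with
a partially ordered metric space structure. -/
theorem stmt_16 {X : Type*} (r : X → X → Prop)
    (hrefl : ∀ x, r x x)
    (htrans : ∀ x y z, r x y → r y z → r x z)
    (hantisymm : ∀ x y, r x y → r y x → x = y)
    (act : ℝ → X → X)
    (hact0 : ∀ x, act 0 x = x)
    (hactadd : ∀ (s t : ℝ) (x : X), act (s + t) x = act s (act t x))
    (hactmono : ∀ (t : ℝ) (x y : X), r x y → r (act t x) (act t y))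
    (hflowmono : ∀ s t : ℝ, s ≤ t → ∀ x : X, r (act s x) (act t x))
    (hfree : ∀ (t : ℝ) (x : X), act t x = x → t = 0)
    (hcof : ∀ x y : X, ∃ s t : ℝ, r (act s y) x ∧ r x (act t y)) :
    (∀ x : X, dSpecLeg r act x x = 0) ∧
    (∀ x y : X, 0 ≤ dSpecLeg r act x y) ∧
    (∀ x y : X, dSpecLeg r act x y = dSpecLeg r act y x) ∧
    (∀ x y z : X, dSpecLeg r act x z ≤ dSpecLeg r act x y + dSpecLeg r act y z) ∧
    (∀ x y z : X, |lplus r act x z - lplus r act y z| ≤ dSpecLeg r act x y) ∧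
    (∀ a b c : X, r a b → r b c → dSpecLeg r act a b ≤ dSpecLeg r act a c) := by
  have hbdd : ∀ x y : X, BddBelow {t : ℝ | r x (act t y)} := by
    intro x y
    obtain ⟨s, -, hs, -⟩ := hcof x y
    exact ⟨s, fun t ht =>
      le_of_rel_act hantisymm hactadd hflowmono hfree (htrans _ _ _ hs ht)⟩
  have hne : ∀ x y : X, {t : ℝ | r x (act t y)}.Nonempty := by
    intro x y
    obtain ⟨-, t, -, ht⟩ := hcof x y
    exact ⟨t, ht⟩
  have htri := lplus_triangle htrans hactadd hactmono hbdd hne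
  have hnonpos : ∀ x y : X, r x y → lplus r act x y ≤ 0 := fun x y h =>
    lplus_le (hbdd x y) (by rwa [hact0])
  have hself : ∀ x : X, lplus r act x x = 0 := by
    intro x
    refine le_antisymm (hnonpos x x (hrefl x)) (le_csInf (hne x x) fun t ht => ?_)
    apply le_of_rel_act hantisymm hactadd hflowmono hfree (x := x)
    rwa [hact0]
  have hle : ∀ x y : X, lplus r act x y ≤ dSpecLeg r act x y := fun _ _ => le_max_left _ _
  have hle' : ∀ x y : X, lplus r act y x ≤ dSpecLeg r act x y := fun _ _ => le_max_right _ _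
  have hnonneg : ∀ x y : X, 0 ≤ dSpecLeg r act x y := by
    intro x y
    linarith [htri x y x, hself x, hle x y, hle' x y]
  refine ⟨fun x => by simp [dSpecLeg, hself], hnonneg, fun x y => max_comm _ _, ?_, ?_, ?_⟩
  · intro x y z
    apply max_le
    · linarith [htri x y z, hle x y, hle y z]
    · linarith [htri z y x, hle' x y, hle' y z]
  · intro x y z
    rw [abs_le]
    constructor
    · linarith [htri y x z, hle' x y]
    · linarith [htri x y z, hle x y]
  · intro a b c hab hbc
    apply max_le
    · exact (hnonpos a b hab).trans (hnonneg a c)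
    · linarith [htri b c a, hnonpos b c hbc, hle' a c]
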